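/- arXiv:2003.09845 — 4 statements merged into one kernel-verified Lean document; each statement's English description precedes it below -/
import Mathlib

section
/- Let ι : ℝ^N → ℝ^N be an involution (ι∘ι = id) whose k-th component ι_k is a polynomial that is D_λ-homogeneous of degree α_k, and let Y = Σ_j b_j·∂_{u_j} be a vector field whose coefficients b_j are D_λ-homogeneous polynomials of degree α_j − 1. Then there exist polynomials c̃₁, …, c̃_N : ℝ^N → ℝ, with each c̃_k D_λ-homogeneous of degree α_k − 1, such that for every smooth f : ℝ^N → ℝ and every u ∈ ℝ^N one has Σ_j b_j(u)·∂_j(f∘ι)(u) = Σ_k c̃_k(ι(u))·(∂_k f)(ι(u)); that is, Y(f∘ι) = (Ỹf)∘ι, where Ỹ := Σ_k c̃_k·∂_{u_k} is again a vector field with D_λ-homogeneous polynomial coefficients of the appropriate degrees. -/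
open MvPolynomial

theorem aux_hasFDerivAt {N : ℕ} (p : MvPolynomial (Fin N) ℝ) (u : Fin N → ℝ) :
    HasFDerivAt (fun v : Fin N → ℝ => eval v p)
      (∑ j, eval u (pderiv j p) • (ContinuousLinearMap.proj (R := ℝ) (φ := fun _ : Fin N => ℝ) j)) u := by
  induction p using MvPolynomial.induction_on with
  | C a => simpa using hasFDerivAt_const a u
  | add p q hp hq =>
    have h := hp.add hq
    simp only [map_add, add_smul, Finset.sum_add_distrib]
    exact h
  | mul_X p i hp =>
    have hX : HasFDerivAt (fun v : Fin N → ℝ => v i)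
      (ContinuousLinearMap.proj (R := ℝ) (φ := fun _ : Fin N => ℝ) i) u :=
      (ContinuousLinearMap.proj (R := ℝ) (φ := fun _ : Fin N => ℝ) i).hasFDerivAt
    have h := hp.mul hX
    simp only [map_mul, eval_X]
    refine h.congr_fderiv ?_
    ext v
    simp [pderiv_X, Pi.single_apply, add_mul, Finset.sum_add_distrib, Finset.mul_sum,
      apply_ite (eval u), mul_assoc, mul_left_comm]

theorem aux_pderiv_scale {N : ℕ} (a : Fin N → ℝ) (j : Fin N) (p : MvPolynomial (Fin N) ℝ) :
    pderiv j (bind₁ (fun i => C (a i) * X i) p)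
      = C (a j) * bind₁ (fun i => C (a i) * X i) (pderiv j p) := by
  induction p using MvPolynomial.induction_on with
  | C r => simp
  | add p q hp hq => simp [hp, hq, mul_add]
  | mul_X p i hp =>
    simp only [map_mul, bind₁_X_right, Derivation.leibniz, hp, smul_eq_mul, map_add, pderiv_C,
      pderiv_X, mul_zero, add_zero]
    by_cases h : i = j
    · subst h; simp; ring
    · simp [Pi.single_apply, h]; ring

theorem aux_eval_bind {N : ℕ} (u : Fin N → ℝ) (s : Fin N → MvPolynomial (Fin N) ℝ)
    (p : MvPolynomial (Fin N) ℝ) :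
    eval u (bind₁ s p) = eval (fun i => eval u (s i)) p := by
  induction p using MvPolynomial.induction_on with
  | C r => simp
  | add p q hp hq => simp [hp, hq]
  | mul_X p i hp => simp [hp]

theorem aux_pderiv_homog {N : ℕ} (a : Fin N → ℝ) (c : ℝ) (p : MvPolynomial (Fin N) ℝ)
    (h : ∀ u, eval (fun i => a i * u i) p = c * eval u p) (j : Fin N) (u : Fin N → ℝ) :
    a j * eval (fun i => a i * u i) (pderiv j p) = c * eval u (pderiv j p) := by
  have h1 : bind₁ (fun i => C (a i) * X i) p = C c * p := by
    apply MvPolynomial.funext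
    intro v
    rw [aux_eval_bind]
    simpa using h v
  have h2 := aux_pderiv_scale a j p
  rw [h1] at h2
  have h3 := congrArg (eval u) h2
  rw [pderiv_C_mul, map_mul (eval u) (C (a j)), aux_eval_bind] at h3
  simp [smul_eval] at h3
  exact h3.symm

/-- Lemma 5.3: if `ι : ℝ^N → ℝ^N` is an involution with polynomial components, the `k`-th
component being `D_λ`-homogeneous of degree `α_k`, and `Y = Σ_j b_j ∂_{u_j}` is a vector
field with polynomial coefficients, `b_j` being `D_λ`-homogeneous of degree `α_j − 1`,
then there are polynomials `c̃_k`, `D_λ`-homogeneous of degree `α_k − 1`, such that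
`Y(f ∘ ι) = (Ỹ f) ∘ ι` with `Ỹ = Σ_k c̃_k ∂_{u_k}`, for every smooth `f`. -/
theorem stmt_7 (N : ℕ) (α : Fin N → ℕ) (hα : ∀ i, 0 < α i)
    (ι : (Fin N → ℝ) → (Fin N → ℝ))
    (hι_inv : ∀ u, ι (ι u) = u)
    (ιP : Fin N → MvPolynomial (Fin N) ℝ)
    (hιP : ∀ k u, ι u k = eval u (ιP k))
    (hι_homog : ∀ k, ∀ l : ℝ, 0 < l → ∀ u : Fin N → ℝ,
      ι (fun i => l ^ (α i) * u i) k = l ^ (α k) * ι u k)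
    (b : Fin N → MvPolynomial (Fin N) ℝ)
    (hb_homog : ∀ j, ∀ l : ℝ, 0 < l → ∀ u : Fin N → ℝ,
      eval (fun i => l ^ (α i) * u i) (b j) = l ^ (α j - 1) * eval u (b j)) :
    ∃ c : Fin N → MvPolynomial (Fin N) ℝ,
      (∀ k, ∀ l : ℝ, 0 < l → ∀ u : Fin N → ℝ,
        eval (fun i => l ^ (α i) * u i) (c k) = l ^ (α k - 1) * eval u (c k)) ∧
      ∀ f : (Fin N → ℝ) → ℝ, ContDiff ℝ (⊤ : ℕ∞) f → ∀ u : Fin N → ℝ,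
        ∑ j, eval u (b j) * fderiv ℝ (f ∘ ι) u (Pi.single j 1) =
        ∑ k, eval (ι u) (c k) * fderiv ℝ f (ι u) (Pi.single k 1) := by
  have hιe : ∀ u, (fun i => eval u (ιP i)) = ι u := fun u => by ext k; rw [hιP]
  have hD : ∀ l : ℝ, 0 < l → ∀ u : Fin N → ℝ,
      ι (fun i => l ^ (α i) * u i) = fun k => l ^ (α k) * ι u k :=
    fun l hl u => by ext k; exact hι_homog k l hl u
  refine ⟨fun k => bind₁ ιP (∑ j, b j * pderiv j (ιP k)), ?_, ?_⟩
  · intro k l hl u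
    simp only [aux_eval_bind, hιe, hD l hl]
    generalize ι u = w
    simp only [map_sum, map_mul, Finset.mul_sum]
    refine Finset.sum_congr rfl fun j _ => ?_
    have h1 := aux_pderiv_homog (fun i => l ^ α i) (l ^ α k) (ιP k)
      (fun u => by rw [← hιP, ← hιP]; exact hι_homog k l hl u) j w
    rw [hb_homog j l hl w]
    obtain ⟨m, hm⟩ := Nat.exists_eq_succ_of_ne_zero (hα j).ne'
    obtain ⟨n, hn⟩ := Nat.exists_eq_succ_of_ne_zero (hα k).ne'
    simp only [hm, hn, Nat.succ_eq_add_one, Nat.add_sub_cancel] at h1 ⊢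
    apply mul_left_cancel₀ hl.ne'
    rw [pow_succ, pow_succ] at h1
    linear_combination (eval w (b j)) * h1
  · intro f hf u
    have hι' : HasFDerivAt ι (ContinuousLinearMap.pi fun k =>
        ∑ j, eval u (pderiv j (ιP k)) •
          (ContinuousLinearMap.proj (R := ℝ) (φ := fun _ : Fin N => ℝ) j)) u := by
      rw [hasFDerivAt_pi']
      intro k
      have := aux_hasFDerivAt (ιP k) u
      simp only [← hιP] at this
      exact this
    have hf' : HasFDerivAt f (fderiv ℝ f (ι u)) (ι u) :=
      (hf.differentiable (by simp) _).hasFDerivAt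
    rw [(hf'.comp u hι').fderiv]
    have hlin : ∀ (L : (Fin N → ℝ) →L[ℝ] ℝ) (v : Fin N → ℝ),
        L v = ∑ k, v k * L (Pi.single k 1) := by
      intro L v
      conv_lhs => rw [pi_eq_sum_univ' v]
      simp [map_sum, Pi.single_apply]
    simp only [aux_eval_bind, hιe, hι_inv, map_sum, map_mul, ContinuousLinearMap.comp_apply,
      Finset.sum_mul]
    rw [Finset.sum_comm]
    refine Finset.sum_congr rfl fun j _ => ?_
    rw [hlin, Finset.mul_sum]
    refine Finset.sum_congr rfl fun k _ => ?_
    simp [Pi.single_apply, mul_assoc]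
end

section
/- Under these hypotheses there exists a constant κ > 1 such that for all x, y ∈ ℝⁿ and every t > 0, t^{−Q/2}·∫_{ℝ^p} exp(−d_Z((x,0),(y,η))²/t) dη ≤ (κ/|B_X(x,√t)|)·exp(−d_X(x,y)²/(2t)). -/
open MeasureTheory

lemma aux_summable (Q : ℝ) :
    Summable fun k : ℕ => Real.exp (-(k : ℝ) ^ 2 / 2) * ((k : ℝ) + 1) ^ Q := by
  have h := Real.summable_pow_mul_exp_neg_nat_mul ⌈Q⌉₊ (r := 1) one_pos
  have h2 := ((summable_nat_add_iff 1).2 h).mul_left (Real.exp (3 / 2))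
  refine Summable.of_nonneg_of_le (fun k => by positivity) (fun k => ?_) h2
  have hk : (1 : ℝ) ≤ (k : ℝ) + 1 := by
    have : (0 : ℝ) ≤ k := Nat.cast_nonneg k
    linarith
  have e1 : ((k : ℝ) + 1) ^ Q ≤ ((k : ℝ) + 1) ^ ⌈Q⌉₊ := by
    rw [← Real.rpow_natCast]
    exact Real.rpow_le_rpow_of_exponent_le hk (Nat.le_ceil Q)
  have e2 : Real.exp (-(k : ℝ) ^ 2 / 2) ≤ Real.exp (3 / 2) * Real.exp (-1 * ((k : ℝ) + 1)) := by
    rw [← Real.exp_add]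
    apply Real.exp_le_exp.2
    nlinarith [sq_nonneg ((k : ℝ) - 1)]
  push_cast
  calc _ ≤ (Real.exp (3 / 2) * Real.exp (-1 * ((k : ℝ) + 1))) * ((k : ℝ) + 1) ^ ⌈Q⌉₊ := by
        gcongr
    _ = _ := by ring

/-- Upper Gaussian estimate for the saturated kernel (Proposition 4.2): under the
projection inequality and the global upper Sanchez-Calle slice estimate, one has
`t^{−Q/2}·∫_{ℝ^p} exp(−d_Z((x,0),(y,η))²/t) dη ≤ (κ/|B_X(x,√t)|)·exp(−d_X(x,y)²/(2t))`. -/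
theorem stmt_11 (n p : ℕ) (hn : 1 ≤ n) (hp : 1 ≤ p) (Q : ℝ) (hQ : 0 < Q)
    (dX : (Fin n → ℝ) → (Fin n → ℝ) → ℝ)
    (hdX_self : ∀ x, dX x x = 0)
    (hdX_pos : ∀ x y, x ≠ y → 0 < dX x y)
    (hdX_symm : ∀ x y, dX x y = dX y x)
    (hdX_tri : ∀ x y z, dX x z ≤ dX x y + dX y z)
    (V : (Fin n → ℝ) → ℝ → ℝ)
    (hV : ∀ x ρ, 0 < ρ → volume {y | dX x y < ρ} = ENNReal.ofReal (V x ρ))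
    (hVpos : ∀ x ρ, 0 < ρ → 0 < V x ρ)
    (dZ : ((Fin n → ℝ) × (Fin p → ℝ)) → ((Fin n → ℝ) × (Fin p → ℝ)) → ℝ)
    (hdZ_self : ∀ u, dZ u u = 0)
    (hdZ_pos : ∀ u v, u ≠ v → 0 < dZ u v)
    (hdZ_symm : ∀ u v, dZ u v = dZ v u)
    (hdZ_tri : ∀ u v w, dZ u w ≤ dZ u v + dZ v w)
    (hdZ_cont : Continuous fun q : ((Fin n → ℝ) × (Fin p → ℝ)) × ((Fin n → ℝ) × (Fin p → ℝ)) =>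
      dZ q.1 q.2)
    (hproj : ∀ (x y : Fin n → ℝ) (ξ η : Fin p → ℝ), dX x y ≤ dZ (x, ξ) (y, η))
    (c₁ : ℝ) (hc₁ : 0 < c₁)
    (hslice : ∀ (x y : Fin n → ℝ) (ρ : ℝ), 0 < ρ →
      volume {η : Fin p → ℝ | dZ (x, 0) (y, η) < ρ} ≤ ENNReal.ofReal (c₁ * ρ ^ Q / V x ρ)) :
    ∃ κ : ℝ, 1 < κ ∧ ∀ (x y : Fin n → ℝ) (t : ℝ), 0 < t →
      ENNReal.ofReal (t ^ (-(Q / 2))) *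
          ∫⁻ η : Fin p → ℝ, ENNReal.ofReal (Real.exp (-(dZ (x, 0) (y, η)) ^ 2 / t)) ≤
        ENNReal.ofReal ((κ / V x (Real.sqrt t)) * Real.exp (-(dX x y) ^ 2 / (2 * t))) := by
  have hsum := aux_summable Q
  set a : ℕ → ℝ := fun k => Real.exp (-(k : ℝ) ^ 2 / 2) * ((k : ℝ) + 1) ^ Q with ha
  have ha0 : ∀ k, 0 ≤ a k := fun k => by simp only [ha]; positivity
  set S := ∑' k, a k with hS
  have hS0 : 0 ≤ S := tsum_nonneg ha0
  refine ⟨c₁ * S + 2, by nlinarith [mul_nonneg hc₁.le hS0], fun x y t ht => ?_⟩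
  have hst : 0 < Real.sqrt t := Real.sqrt_pos.2 ht
  have hV0 := hVpos x _ hst
  have hX0 : 0 ≤ dX x y := by
    by_cases h : x = y
    · rw [h, hdX_self]
    · exact (hdX_pos x y h).le
  set s := Real.sqrt t with hs
  have hss : s ^ 2 = t := Real.sq_sqrt ht.le
  set f : (Fin p → ℝ) → ℝ := fun η => dZ (x, 0) (y, η) with hf
  have hfc : Continuous f :=
    hdZ_cont.comp (f := fun η : Fin p → ℝ => (((x, 0) : (Fin n → ℝ) × (Fin p → ℝ)), (y, η)))
      (by fun_prop)
  have hfX : ∀ η, dX x y ≤ f η := fun η => hproj x y 0 η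
  set A : ℕ → Set (Fin p → ℝ) := fun k => {η | f η < ((k : ℝ) + 1) * s} with hA
  have hAm : ∀ k, MeasurableSet (A k) := fun k =>
    (isOpen_lt hfc continuous_const).measurableSet
  have hvol : ∀ k : ℕ, volume (A k) ≤
      ENNReal.ofReal (c₁ * (((k : ℝ) + 1) ^ Q * t ^ (Q / 2)) / V x s) := by
    intro k
    have hk0 : (0 : ℝ) ≤ k := Nat.cast_nonneg k
    have hr : 0 < ((k : ℝ) + 1) * s := by positivity
    refine (hslice x y _ hr).trans (ENNReal.ofReal_le_ofReal ?_)
    have hmono : V x s ≤ V x (((k : ℝ) + 1) * s) := by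
      have h1 : volume {y | dX x y < s} ≤ volume {y | dX x y < ((k : ℝ) + 1) * s} := by
        apply measure_mono
        intro z hz
        have hz' : dX x z < s := hz
        show dX x z < _
        nlinarith
      rw [hV x _ hst, hV x _ hr] at h1
      exact (ENNReal.ofReal_le_ofReal_iff (hVpos x _ hr).le).1 h1
    have hpow : (((k : ℝ) + 1) * s) ^ Q = ((k : ℝ) + 1) ^ Q * t ^ (Q / 2) := by
      rw [Real.mul_rpow (by positivity) hst.le, ← hss, ← Real.rpow_natCast,
        ← Real.rpow_mul hst.le]
      congr 2
      push_cast
      ring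
    rw [hpow]
    gcongr
  set E := Real.exp (-(dX x y) ^ 2 / (2 * t)) with hE
  have hE0 : 0 < E := Real.exp_pos _
  have hpt : ∀ η, ENNReal.ofReal (Real.exp (-(f η) ^ 2 / t)) ≤
      ENNReal.ofReal E * ∑' k : ℕ, (A k).indicator
        (fun _ => ENNReal.ofReal (Real.exp (-(k : ℝ) ^ 2 / 2))) η := by
    intro η
    have hf0 : 0 ≤ f η := hX0.trans (hfX η)
    have hq0 : 0 ≤ f η / s := by positivity
    have hmem : η ∈ A ⌊f η / s⌋₊ := by
      have := Nat.lt_floor_add_one (f η / s)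
      rw [div_lt_iff₀ hst] at this
      exact this
    have hle : (⌊f η / s⌋₊ : ℝ) ≤ f η / s := Nat.floor_le hq0
    have h1 := ENNReal.le_tsum (f := fun k : ℕ => (A k).indicator
        (fun _ => ENNReal.ofReal (Real.exp (-(k : ℝ) ^ 2 / 2))) η) ⌊f η / s⌋₊
    simp only [Set.indicator_of_mem hmem] at h1
    refine le_trans ?_ (mul_le_mul_right h1 _)
    rw [← ENNReal.ofReal_mul hE0.le]
    apply ENNReal.ofReal_le_ofReal
    rw [hE, ← Real.exp_add]
    apply Real.exp_le_exp.2
    have h2 : (⌊f η / s⌋₊ : ℝ) ^ 2 ≤ (f η) ^ 2 / t := by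
      rw [← hss, ← div_pow]
      exact pow_le_pow_left₀ (Nat.cast_nonneg _) hle 2
    have h3 : (dX x y) ^ 2 / t ≤ (f η) ^ 2 / t := by
      have := hfX η
      gcongr
    have h4 : -(dX x y) ^ 2 / (2 * t) = -((dX x y) ^ 2 / t) / 2 := by
      field_simp
    rw [h4, neg_div]
    linarith
  have hint : ∫⁻ η, ENNReal.ofReal (Real.exp (-(f η) ^ 2 / t)) ≤
      ENNReal.ofReal (E * (c₁ * t ^ (Q / 2) / V x s * S)) := by
    have hC0 : 0 ≤ c₁ * t ^ (Q / 2) / V x s := by positivity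
    calc _ ≤ ∫⁻ η, ENNReal.ofReal E * ∑' k : ℕ, (A k).indicator
                (fun _ => ENNReal.ofReal (Real.exp (-(k : ℝ) ^ 2 / 2))) η := lintegral_mono hpt
      _ = ENNReal.ofReal E * ∑' k : ℕ, ENNReal.ofReal (Real.exp (-(k : ℝ) ^ 2 / 2)) *
            volume (A k) := by
          rw [lintegral_const_mul' _ _ ENNReal.ofReal_ne_top, lintegral_tsum
            (fun k => (measurable_const.indicator (hAm k)).aemeasurable)]
          simp_rw [lintegral_indicator_const (hAm _)]
      _ ≤ ENNReal.ofReal E * ∑' k : ℕ, ENNReal.ofReal (c₁ * t ^ (Q / 2) / V x s * a k) := by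
          refine mul_le_mul_right (ENNReal.tsum_le_tsum fun k => ?_) _
          refine (mul_le_mul_right (hvol k) _).trans ?_
          rw [← ENNReal.ofReal_mul (Real.exp_pos _).le]
          apply le_of_eq
          congr 1
          simp only [ha]
          ring
      _ = _ := by
          rw [← ENNReal.ofReal_tsum_of_nonneg (fun k => mul_nonneg hC0 (ha0 k))
            (hsum.mul_left _), tsum_mul_left, ← ENNReal.ofReal_mul hE0.le]
  refine (mul_le_mul_right hint _).trans ?_
  rw [← ENNReal.ofReal_mul (by positivity)]
  apply ENNReal.ofReal_le_ofReal
  have hT : t ^ (-(Q / 2)) * t ^ (Q / 2) = 1 := by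
    rw [← Real.rpow_add ht]; simp
  calc t ^ (-(Q / 2)) * (E * (c₁ * t ^ (Q / 2) / V x s * S))
      = (t ^ (-(Q / 2)) * t ^ (Q / 2)) * ((c₁ * S) / V x s * E) := by ring
    _ = (c₁ * S) / V x s * E := by rw [hT, one_mul]
    _ ≤ (c₁ * S + 2) / V x s * E := by
        gcongr
        linarith
end

section
/- Under these hypotheses there exists a constant ϑ > 1 such that for all x, y ∈ ℝⁿ and every t > 0, t^{−Q/2}·∫_{ℝ^p} exp(−d_Z((x,0),(y,η))²/t) dη ≥ (1/(ϑ·|B_X(x,√t)|))·exp(−ϑ·d_X(x,y)²/t). -/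
open MeasureTheory

/-- Lower Gaussian estimate for the saturated kernel (Proposition 4.4): under the
annulus property and the global lower Sanchez-Calle slice estimate, one has
`t^{−Q/2}·∫_{ℝ^p} exp(−d_Z((x,0),(y,η))²/t) dη ≥ (1/(ϑ·|B_X(x,√t)|))·exp(−ϑ·d_X(x,y)²/t)`. -/
theorem stmt_13 (n p : ℕ) (hn : 1 ≤ n) (hp : 1 ≤ p) (Q : ℝ) (hQ : 0 < Q)
    (dX : (Fin n → ℝ) → (Fin n → ℝ) → ℝ)
    (hdX_self : ∀ x, dX x x = 0)
    (hdX_pos : ∀ x y, x ≠ y → 0 < dX x y)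
    (hdX_symm : ∀ x y, dX x y = dX y x)
    (hdX_tri : ∀ x y z, dX x z ≤ dX x y + dX y z)
    (V : (Fin n → ℝ) → ℝ → ℝ)
    (hV : ∀ x ρ, 0 < ρ → volume {y | dX x y < ρ} = ENNReal.ofReal (V x ρ))
    (hVpos : ∀ x ρ, 0 < ρ → 0 < V x ρ)
    (q : ℕ) (hq : 0 < q) (γ₂ : ℝ) (hγ₂ : 0 < γ₂)
    (hratio : ∀ (x : Fin n → ℝ) (r ρ : ℝ), 0 < r → r < ρ →
      V x ρ / V x r ≤ γ₂ * (ρ / r) ^ q)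
    (dZ : ((Fin n → ℝ) × (Fin p → ℝ)) → ((Fin n → ℝ) × (Fin p → ℝ)) → ℝ)
    (hdZ_self : ∀ u, dZ u u = 0)
    (hdZ_pos : ∀ u v, u ≠ v → 0 < dZ u v)
    (hdZ_symm : ∀ u v, dZ u v = dZ v u)
    (hdZ_tri : ∀ u v w, dZ u w ≤ dZ u v + dZ v w)
    (hdZ_cont : Continuous fun q : ((Fin n → ℝ) × (Fin p → ℝ)) × ((Fin n → ℝ) × (Fin p → ℝ)) =>
      dZ q.1 q.2)
    (hannulus : ∀ (x y : Fin n → ℝ) (a : ℝ), dX x y < a →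
      ∃ η' : Fin p → ℝ,
        {η : Fin p → ℝ | dZ (y, η') (y, η) < a / 2} ⊆
        {η : Fin p → ℝ | a ≤ dZ (x, 0) (y, η) ∧ dZ (x, 0) (y, η) < 2 * a})
    (c₂ : ℝ) (hc₂ : 0 < c₂)
    (hslice : ∀ (y : Fin n → ℝ) (η' : Fin p → ℝ) (ρ : ℝ), 0 < ρ →
      ENNReal.ofReal (c₂ * ρ ^ Q / V y ρ) ≤
        volume {η : Fin p → ℝ | dZ (y, η') (y, η) < ρ}) :
    ∃ ϑ : ℝ, 1 < ϑ ∧ ∀ (x y : Fin n → ℝ) (t : ℝ), 0 < t →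
      ENNReal.ofReal ((1 / (ϑ * V x (Real.sqrt t))) * Real.exp (-ϑ * (dX x y) ^ 2 / t)) ≤
        ENNReal.ofReal (t ^ (-(Q / 2))) *
          ∫⁻ η : Fin p → ℝ, ENNReal.ofReal (Real.exp (-(dZ (x, 0) (y, η)) ^ 2 / t)) := by
  set K : ℝ := 2 ^ Q * Real.exp 8 * γ₂ * 2 ^ q * Real.exp q / c₂ with hK
  have hKpos : 0 < K := by positivity
  have hdX_nonneg : ∀ x y, 0 ≤ dX x y := by
    intro x y
    by_cases h : x = y
    · subst h; rw [hdX_self]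
    · exact (hdX_pos x y h).le
  have hq0 : (0 : ℝ) ≤ q := Nat.cast_nonneg q
  refine ⟨K + 8 + q, by linarith, ?_⟩
  intro x y t ht
  set s := Real.sqrt t with hs
  have hspos : 0 < s := Real.sqrt_pos.mpr ht
  have hst : s ^ 2 = t := Real.sq_sqrt ht.le
  set d := dX x y with hd
  have hd0 : 0 ≤ d := hdX_nonneg x y
  set a := d + s with ha
  have hapos : 0 < a := by positivity
  obtain ⟨η', hη'⟩ := hannulus x y a (by linarith)
  set S : Set (Fin p → ℝ) := {η : Fin p → ℝ | dZ (y, η') (y, η) < a / 2} with hS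
  have hSm : MeasurableSet S := by
    apply IsOpen.measurableSet
    apply isOpen_lt _ continuous_const
    exact hdZ_cont.comp (f := fun η : Fin p → ℝ => (((y, η') : (Fin n → ℝ) × (Fin p → ℝ)),
      ((y, η) : (Fin n → ℝ) × (Fin p → ℝ)))) (by fun_prop)
  have hVx := hVpos x s hspos
  have hVy := hVpos y (a / 2) (by positivity)
  have hVx2 := hVpos x (2 * a) (by positivity)
  set D := d ^ 2 / t with hD
  have hD0 : 0 ≤ D := by positivity
  -- volume comparison
  have hV1 : V y (a / 2) ≤ V x (2 * a) := by
    have h : volume {z | dX y z < a / 2} ≤ volume {z | dX x z < 2 * a} := by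
      apply measure_mono
      intro z hz
      simp only [Set.mem_setOf_eq] at hz ⊢
      have := hdX_tri x y z
      linarith
    rw [hV y _ (by positivity), hV x _ (by positivity)] at h
    exact (ENNReal.ofReal_le_ofReal_iff hVx2.le).1 h
  have hV2 : V x (2 * a) ≤ γ₂ * (2 * a / s) ^ q * V x s := by
    have h := hratio x s (2 * a) hspos (by linarith)
    rwa [div_le_iff₀ hVx] at h
  have hpow : (2 * a / s) ^ q ≤ 2 ^ q * Real.exp q * Real.exp (q * D) := by
    have e1 : 2 * a / s = 2 * (1 + d / s) := by
      rw [ha]; field_simp; ring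
    have e2 : 1 + d / s ≤ Real.exp (1 + D) := by
      have h1 : D = (d / s) ^ 2 := by rw [hD, ← hst, div_pow]
      have h2 := Real.add_one_le_exp (1 + D)
      nlinarith [sq_nonneg (d / s - 1 / 2)]
    rw [e1, mul_pow, mul_assoc, ← Real.exp_add]
    have e3 : (1 + d / s) ^ q ≤ Real.exp (1 + D) ^ q := by gcongr
    rw [← Real.exp_nat_mul] at e3
    have e4 : (q : ℝ) * (1 + D) = q + q * D := by ring
    rw [e4] at e3
    gcongr
  have hV3 : V y (a / 2) ≤ γ₂ * (2 ^ q * Real.exp q * Real.exp (q * D)) * V x s := by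
    refine hV1.trans (hV2.trans ?_)
    gcongr
  have hexp : ∀ η ∈ S, Real.exp (-8) * Real.exp (-(8 * D)) ≤
      Real.exp (-(dZ (x, 0) (y, η)) ^ 2 / t) := by
    intro η hη
    obtain ⟨h1, h2⟩ := hη' hη
    rw [← Real.exp_add]
    apply Real.exp_le_exp.mpr
    have h3 : (dZ (x, 0) (y, η)) ^ 2 ≤ 8 * d ^ 2 + 8 * t := by
      have : (dZ (x, 0) (y, η)) ^ 2 ≤ (2 * a) ^ 2 := by
        apply pow_le_pow_left₀ (by linarith) h2.le
      rw [← hst]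
      nlinarith [sq_nonneg (d - s)]
    rw [le_div_iff₀ ht, hD]
    have : (-8 + -(8 * (d ^ 2 / t))) * t = -(8 * d ^ 2 + 8 * t) := by
      field_simp; ring
    linarith
  have hint : ENNReal.ofReal (Real.exp (-8) * Real.exp (-(8 * D))) *
      ENNReal.ofReal (c₂ * (a / 2) ^ Q / V y (a / 2)) ≤
      ∫⁻ η : Fin p → ℝ, ENNReal.ofReal (Real.exp (-(dZ (x, 0) (y, η)) ^ 2 / t)) := by
    calc _ ≤ ENNReal.ofReal (Real.exp (-8) * Real.exp (-(8 * D))) * volume S := by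
          gcongr
          exact hslice y η' (a / 2) (by positivity)
      _ = ∫⁻ η in S, ENNReal.ofReal (Real.exp (-8) * Real.exp (-(8 * D))) := by
          rw [setLIntegral_const]
      _ ≤ ∫⁻ η in S, ENNReal.ofReal (Real.exp (-(dZ (x, 0) (y, η)) ^ 2 / t)) :=
          setLIntegral_mono' hSm fun η hη => ENNReal.ofReal_le_ofReal (hexp η hη)
      _ ≤ _ := setLIntegral_le_lintegral _ _
  refine le_trans ?_ (mul_le_mul_right hint _)
  rw [← ENNReal.ofReal_mul (by positivity), ← ENNReal.ofReal_mul (by positivity)]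
  apply ENNReal.ofReal_le_ofReal
  have hpw : (2 ^ Q)⁻¹ ≤ t ^ (-(Q / 2)) * (a / 2) ^ Q := by
    have h1 : (s / 2) ^ Q ≤ (a / 2) ^ Q := by
      apply Real.rpow_le_rpow (by positivity) (by linarith) hQ.le
    have h2 : t ^ (-(Q / 2)) = (s ^ Q)⁻¹ := by
      rw [Real.rpow_neg ht.le, hs, Real.sqrt_eq_rpow, ← Real.rpow_mul ht.le]
      congr 2; ring
    have hsQ : 0 < s ^ Q := Real.rpow_pos_of_pos hspos Q
    calc (2 ^ Q)⁻¹ = (s ^ Q)⁻¹ * (s / 2) ^ Q := by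
          rw [Real.div_rpow hspos.le (by norm_num)]; field_simp
      _ ≤ _ := by rw [h2]; gcongr
  have hA : (-(K + 8 + q)) * d ^ 2 / t = -((K + 8 + q) * D) := by rw [hD]; ring
  rw [hA]
  calc 1 / ((K + 8 + q) * V x s) * Real.exp (-((K + 8 + q) * D))
      ≤ 1 / (K * V x s) * Real.exp (-((8 + q) * D)) := by
        gcongr <;> linarith
    _ = (2 ^ Q)⁻¹ * (Real.exp (-8) * Real.exp (-(8 * D)) *
        (c₂ / (γ₂ * (2 ^ q * Real.exp q * Real.exp (q * D)) * V x s))) := by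
        have : Real.exp (-((8 + q) * D)) = Real.exp (-(8 * D)) * (Real.exp (q * D))⁻¹ := by
          rw [← Real.exp_neg, ← Real.exp_add]; congr 1; ring
        rw [this, hK, Real.exp_neg 8]
        field_simp
    _ ≤ (t ^ (-(Q / 2)) * (a / 2) ^ Q) * (Real.exp (-8) * Real.exp (-(8 * D)) *
        (c₂ / V y (a / 2))) := by
        gcongr
    _ = _ := by ring
end

section
/- Under these hypotheses there exists a constant ϱ > 1 such that for all x, y ∈ ℝⁿ and every t > 0, (1/(ϱ·|B_X(x,√t)|))·exp(−ϱ·d_X(x,y)²/t) ≤ γ(t,x,y) ≤ (ϱ/|B_X(x,√t)|)·exp(−d_X(x,y)²/(ϱ·t)). -/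
open MeasureTheory

lemma aux_summ (Q c : ℝ) (hc : 1 ≤ c) :
    Summable (fun k : ℕ => ((k:ℝ) + 1) ^ Q * Real.exp (-(k:ℝ) ^ 2 / (2 * c))) := by
  have hr : 0 < 1 / (2 * c) := by positivity
  have h0 := Real.summable_pow_mul_exp_neg_nat_mul (⌈Q⌉₊) hr
  have h1 := ((summable_nat_add_iff 1).2 h0).mul_left (Real.exp (1 / (2 * c)))
  refine Summable.of_nonneg_of_le (fun k => by positivity) (fun k => ?_) h1
  have e1 : ((k:ℝ) + 1) ^ Q ≤ ((k:ℝ) + 1) ^ ⌈Q⌉₊ := by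
    rw [← Real.rpow_natCast]
    exact Real.rpow_le_rpow_of_exponent_le (by linarith [(Nat.cast_nonneg k : (0:ℝ) ≤ k)])
      (Nat.le_ceil Q)
  have hk : (k:ℝ) ≤ (k:ℝ) ^ 2 := by
    exact_mod_cast (Nat.le_self_pow (by norm_num) k)
  have e2 : Real.exp (-(k:ℝ) ^ 2 / (2 * c)) ≤
      Real.exp (1 / (2 * c)) * Real.exp (-(1 / (2 * c)) * ((k + 1 : ℕ) : ℝ)) := by
    rw [← Real.exp_add]
    apply Real.exp_le_exp.2
    have : 1 / (2 * c) + -(1 / (2 * c)) * ((k + 1 : ℕ) : ℝ) = -(k:ℝ) / (2 * c) := by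
      push_cast; ring
    rw [this]
    gcongr
  calc _ ≤ ((k:ℝ) + 1) ^ ⌈Q⌉₊ *
        (Real.exp (1 / (2 * c)) * Real.exp (-(1 / (2 * c)) * ((k + 1 : ℕ) : ℝ))) := by gcongr
    _ = _ := by push_cast; ring

lemma aux_upper {α : Type*} [MeasurableSpace α] (μ : Measure α) (f : α → ℝ) (hf : Measurable f)
    (hf0 : ∀ a, 0 ≤ f a) (s c Q M : ℝ) (hs : 0 < s) (hc : 1 ≤ c) (hM : 0 ≤ M)
    (h : ∀ k : ℕ, μ {a | f a < ((k:ℝ) + 1) * s} ≤ ENNReal.ofReal (M * ((k:ℝ) + 1) ^ Q)) :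
    ∫⁻ a, ENNReal.ofReal (Real.exp (-(f a) ^ 2 / (2 * c * s ^ 2))) ∂μ ≤
      ENNReal.ofReal (M * ∑' k : ℕ, ((k:ℝ) + 1) ^ Q * Real.exp (-(k:ℝ) ^ 2 / (2 * c))) := by
  have hms : ∀ k : ℕ, MeasurableSet {a | f a < ((k:ℝ) + 1) * s} := fun k =>
    measurableSet_lt hf measurable_const
  calc _ ≤ ∫⁻ a, ∑' k : ℕ, ({a | f a < ((k:ℝ) + 1) * s}).indicator
        (fun _ => ENNReal.ofReal (Real.exp (-(k:ℝ) ^ 2 / (2 * c)))) a ∂μ := by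
        apply lintegral_mono
        intro a
        refine le_trans ?_ (ENNReal.le_tsum ⌊f a / s⌋₊)
        have hk1 : f a < ((⌊f a / s⌋₊ : ℝ) + 1) * s := by
          have := Nat.lt_floor_add_one (f a / s)
          rwa [div_lt_iff₀ hs] at this
        have hk2 : (⌊f a / s⌋₊ : ℝ) ≤ f a / s := Nat.floor_le (div_nonneg (hf0 a) hs.le)
        rw [Set.indicator_of_mem (by exact hk1)]
        apply ENNReal.ofReal_le_ofReal
        apply Real.exp_le_exp.2
        have : -(f a) ^ 2 / (2 * c * s ^ 2) = -(f a / s) ^ 2 / (2 * c) := by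
          field_simp
        rw [this]
        gcongr
    _ = ∑' k : ℕ, ENNReal.ofReal (Real.exp (-(k:ℝ) ^ 2 / (2 * c))) *
          μ {a | f a < ((k:ℝ) + 1) * s} := by
        rw [lintegral_tsum (fun k => (measurable_const.indicator (hms k)).aemeasurable)]
        congr 1; ext k
        rw [lintegral_indicator_const (hms k)]
    _ ≤ ∑' k : ℕ, ENNReal.ofReal (M * (((k:ℝ) + 1) ^ Q * Real.exp (-(k:ℝ) ^ 2 / (2 * c)))) := by
        apply ENNReal.tsum_le_tsum
        intro k
        calc _ ≤ ENNReal.ofReal (Real.exp (-(k:ℝ) ^ 2 / (2 * c))) *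
              ENNReal.ofReal (M * ((k:ℝ) + 1) ^ Q) := by gcongr; exact h k
          _ = _ := by
            rw [← ENNReal.ofReal_mul (by positivity)]
            congr 1; ring
    _ = _ := by
        rw [← tsum_mul_left]
        exact (ENNReal.ofReal_tsum_of_nonneg (fun k => by positivity)
          ((aux_summ Q c hc).mul_left M)).symm

/-- Main global two-sided Gaussian estimate (Theorem 1.1(i)): if `γ` satisfies the
two-sided quasi-Gaussian bound in terms of the saturated lifted kernel, then there
exists `ϱ > 1` with
`(1/(ϱ·|B_X(x,√t)|))·exp(−ϱ·d_X(x,y)²/t) ≤ γ(t,x,y) ≤ (ϱ/|B_X(x,√t)|)·exp(−d_X(x,y)²/(ϱt))`. -/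
theorem stmt_14 (n p : ℕ) (hn : 1 ≤ n) (hp : 1 ≤ p) (Q : ℝ) (hQ : 0 < Q)
    (dX : (Fin n → ℝ) → (Fin n → ℝ) → ℝ)
    (hdX_self : ∀ x, dX x x = 0)
    (hdX_pos : ∀ x y, x ≠ y → 0 < dX x y)
    (hdX_symm : ∀ x y, dX x y = dX y x)
    (hdX_tri : ∀ x y z, dX x z ≤ dX x y + dX y z)
    (V : (Fin n → ℝ) → ℝ → ℝ)
    (hV : ∀ x ρ, 0 < ρ → volume {y | dX x y < ρ} = ENNReal.ofReal (V x ρ))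
    (hVpos : ∀ x ρ, 0 < ρ → 0 < V x ρ)
    (n₀ q : ℕ) (hn₀ : 0 < n₀) (hn₀q : n₀ ≤ q) (γ₁ γ₂ : ℝ) (hγ₁ : 0 < γ₁) (hγ₂ : 0 < γ₂)
    (hratio : ∀ (x : Fin n → ℝ) (r ρ : ℝ), 0 < r → r < ρ →
      γ₁ * (ρ / r) ^ n₀ ≤ V x ρ / V x r ∧ V x ρ / V x r ≤ γ₂ * (ρ / r) ^ q)
    (dZ : ((Fin n → ℝ) × (Fin p → ℝ)) → ((Fin n → ℝ) × (Fin p → ℝ)) → ℝ)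
    (hdZ_self : ∀ u, dZ u u = 0)
    (hdZ_pos : ∀ u v, u ≠ v → 0 < dZ u v)
    (hdZ_symm : ∀ u v, dZ u v = dZ v u)
    (hdZ_tri : ∀ u v w, dZ u w ≤ dZ u v + dZ v w)
    (hdZ_cont : Continuous fun q : ((Fin n → ℝ) × (Fin p → ℝ)) × ((Fin n → ℝ) × (Fin p → ℝ)) =>
      dZ q.1 q.2)
    (hproj : ∀ (x y : Fin n → ℝ) (ξ η : Fin p → ℝ), dX x y ≤ dZ (x, ξ) (y, η))
    (c₁ : ℝ) (hc₁ : 0 < c₁)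
    (hslice_up : ∀ (x y : Fin n → ℝ) (ρ : ℝ), 0 < ρ →
      volume {η : Fin p → ℝ | dZ (x, 0) (y, η) < ρ} ≤ ENNReal.ofReal (c₁ * ρ ^ Q / V x ρ))
    (hannulus : ∀ (x y : Fin n → ℝ) (a : ℝ), dX x y < a →
      ∃ η' : Fin p → ℝ,
        {η : Fin p → ℝ | dZ (y, η') (y, η) < a / 2} ⊆
        {η : Fin p → ℝ | a ≤ dZ (x, 0) (y, η) ∧ dZ (x, 0) (y, η) < 2 * a})
    (c₂ : ℝ) (hc₂ : 0 < c₂)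
    (hslice_low : ∀ (y : Fin n → ℝ) (η' : Fin p → ℝ) (ρ : ℝ), 0 < ρ →
      ENNReal.ofReal (c₂ * ρ ^ Q / V y ρ) ≤
        volume {η : Fin p → ℝ | dZ (y, η') (y, η) < ρ})
    (γ : ℝ → (Fin n → ℝ) → (Fin n → ℝ) → ℝ)
    (c : ℝ) (hc : 1 ≤ c)
    (hγ_low : ∀ (x y : Fin n → ℝ) (t : ℝ), 0 < t →
      ENNReal.ofReal (c⁻¹ * t ^ (-(Q / 2))) *
          ∫⁻ η : Fin p → ℝ, ENNReal.ofReal (Real.exp (-c * (dZ (x, 0) (y, η)) ^ 2 / t)) ≤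
        ENNReal.ofReal (γ t x y))
    (hγ_up : ∀ (x y : Fin n → ℝ) (t : ℝ), 0 < t →
      ENNReal.ofReal (γ t x y) ≤
        ENNReal.ofReal (c * t ^ (-(Q / 2))) *
          ∫⁻ η : Fin p → ℝ, ENNReal.ofReal (Real.exp (-(dZ (x, 0) (y, η)) ^ 2 / (c * t)))) :
    ∃ ϱ : ℝ, 1 < ϱ ∧ ∀ (x y : Fin n → ℝ) (t : ℝ), 0 < t →
      (1 / (ϱ * V x (Real.sqrt t))) * Real.exp (-ϱ * (dX x y) ^ 2 / t) ≤ γ t x y ∧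
      γ t x y ≤ (ϱ / V x (Real.sqrt t)) * Real.exp (-(dX x y) ^ 2 / (ϱ * t)) := by
  have hdX0 : ∀ x y, 0 ≤ dX x y := fun x y => by
    by_cases h : x = y
    · rw [h, hdX_self]
    · exact (hdX_pos x y h).le
  have hVmono : ∀ x y r ρ, 0 < r → dX x y + r ≤ ρ → V y r ≤ V x ρ := by
    intro x y r ρ hr hρ
    have hρ0 : 0 < ρ := by linarith [hdX0 x y]
    have : volume {z | dX y z < r} ≤ volume {z | dX x z < ρ} := by
      apply measure_mono
      intro z hz
      have hz' : dX y z < r := hz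
      have := hdX_tri x y z
      show dX x z < ρ
      linarith
    rw [hV _ _ hr, hV _ _ hρ0] at this
    exact (ENNReal.ofReal_le_ofReal_iff (hVpos _ _ hρ0).le).1 this
  have hcont : ∀ u y, Continuous fun η : Fin p → ℝ => dZ u (y, η) := fun u y =>
    hdZ_cont.comp (by fun_prop : Continuous fun η : Fin p → ℝ => (u, (y, η)))
  have hc0 : 0 < c := by linarith
  set S : ℝ := ∑' k : ℕ, ((k:ℝ) + 1) ^ Q * Real.exp (-(k:ℝ) ^ 2 / (2 * c)) with hS
  have hS0 : 0 ≤ S := tsum_nonneg fun k => by positivity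
  set A : ℝ := c⁻¹ * Real.exp (-(8 * c)) * c₂ * (1 / 2 : ℝ) ^ Q / (γ₂ * 2 ^ q * Real.exp q) with hA
  have hA0 : 0 < A := by positivity
  have key : ∀ (x y : Fin n → ℝ) (s : ℝ), 0 < s →
      (A / V x s) * Real.exp (-(8 * c + q) * (dX x y) ^ 2 / s ^ 2) ≤ γ (s ^ 2) x y ∧
      γ (s ^ 2) x y ≤ (c * c₁ * S / V x s) * Real.exp (-(dX x y) ^ 2 / (2 * c * s ^ 2)) := by
    intro x y s hs
    have hV0 := hVpos x s hs
    have hpow : (s ^ 2) ^ (-(Q / 2)) = (s ^ Q)⁻¹ := by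
      rw [← Real.rpow_natCast, ← Real.rpow_mul hs.le, ← Real.rpow_neg hs.le]
      congr 1; push_cast; ring
    have hsQ : 0 < s ^ Q := Real.rpow_pos_of_pos hs Q
    have hd0 := hdX0 x y
    set d := dX x y with hd
    constructor
    · set a := d + s with ha
      have ha0 : 0 < a := by positivity
      obtain ⟨η', hη'⟩ := hannulus x y a (by linarith)
      have h1 := hslice_low y η' (a / 2) (by positivity)
      have hms : MeasurableSet {η : Fin p → ℝ | dZ (y, η') (y, η) < a / 2} :=
        measurableSet_lt (hcont _ _).measurable measurable_const
      have h2 : ENNReal.ofReal (Real.exp (-c * (2 * a) ^ 2 / s ^ 2)) *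
          ENNReal.ofReal (c₂ * (a / 2) ^ Q / V y (a / 2)) ≤
          ∫⁻ η : Fin p → ℝ, ENNReal.ofReal (Real.exp (-c * (dZ (x, 0) (y, η)) ^ 2 / s ^ 2)) := by
        calc _ ≤ ENNReal.ofReal (Real.exp (-c * (2 * a) ^ 2 / s ^ 2)) *
              volume {η : Fin p → ℝ | dZ (y, η') (y, η) < a / 2} := by gcongr
          _ = ∫⁻ η, ({η : Fin p → ℝ | dZ (y, η') (y, η) < a / 2}).indicator
              (fun _ => ENNReal.ofReal (Real.exp (-c * (2 * a) ^ 2 / s ^ 2))) η :=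
              (lintegral_indicator_const hms _).symm
          _ ≤ _ := by
            apply lintegral_mono
            intro η
            apply Set.indicator_le' (f := fun _ => ENNReal.ofReal (Real.exp (-c * (2 * a) ^ 2 / s ^ 2)))
              (g := fun η => ENNReal.ofReal (Real.exp (-c * (dZ (x, 0) (y, η)) ^ 2 / s ^ 2)))
            · intro η hη
              obtain ⟨h3, h4⟩ := hη' hη
              apply ENNReal.ofReal_le_ofReal
              apply Real.exp_le_exp.2
              have h5 : (dZ (x, 0) (y, η)) ^ 2 ≤ (2 * a) ^ 2 := by
                apply pow_le_pow_left₀ (by linarith) h4.le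
              rw [neg_mul, neg_mul]
              gcongr
            · intro η _; exact zero_le
      have h3 := hγ_low x y (s ^ 2) (by positivity)
      have h4 := le_trans (mul_le_mul_right h2 _) h3
      rw [← ENNReal.ofReal_mul (by positivity), ← ENNReal.ofReal_mul (by positivity), hpow] at h4
      have hVy := hVpos y (a / 2) (by positivity)
      have hpos : 0 < c⁻¹ * (s ^ Q)⁻¹ *
          (Real.exp (-c * (2 * a) ^ 2 / s ^ 2) * (c₂ * (a / 2) ^ Q / V y (a / 2))) := by
        positivity
      have h5 := (ENNReal.ofReal_le_ofReal_iff' ).1 h4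
      have h6 := h5.resolve_right (not_le.2 hpos)
      refine le_trans ?_ h6
      have e1 : Real.exp (-(8 * c)) * Real.exp (-(8 * c) * d ^ 2 / s ^ 2) ≤
          Real.exp (-c * (2 * a) ^ 2 / s ^ 2) := by
        rw [← Real.exp_add]
        apply Real.exp_le_exp.2
        have : -(8 * c) + -(8 * c) * d ^ 2 / s ^ 2 = -(8 * c) * (s ^ 2 + d ^ 2) / s ^ 2 := by
          field_simp; ring
        rw [this]
        gcongr ?_ / _
        rw [ha]
        nlinarith [mul_nonneg hc0.le (sq_nonneg (d - s))]
      have e2 : (1 / 2 : ℝ) ^ Q * s ^ Q ≤ (a / 2) ^ Q := by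
        rw [← Real.mul_rpow (by norm_num) hs.le]
        apply Real.rpow_le_rpow (by positivity) _ hQ.le
        rw [ha]; linarith
      have e3 : V y (a / 2) ≤ γ₂ * 2 ^ q * Real.exp q * Real.exp (q * d ^ 2 / s ^ 2) * V x s := by
        have f1 : V y (a / 2) ≤ V x (2 * a) := hVmono x y _ _ (by positivity) (by linarith)
        have f2 := (hratio x s (2 * a) hs (by linarith)).2
        rw [div_le_iff₀ hV0] at f2
        refine f1.trans (f2.trans ?_)
        apply mul_le_mul_of_nonneg_right _ hV0.le
        have f3 : 2 * a / s ≤ 2 * Real.exp (1 + d ^ 2 / s ^ 2) := by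
          have g1 : d / s + 1 ≤ Real.exp (d / s) := Real.add_one_le_exp _
          have g2 : Real.exp (d / s) ≤ Real.exp (1 + d ^ 2 / s ^ 2) := by
            apply Real.exp_le_exp.2
            rw [← div_pow]
            nlinarith [sq_nonneg (d / s - 1)]
          have : 2 * a / s = 2 * (d / s + 1) := by rw [ha]; field_simp
          rw [this]; linarith
        have f4 : (2 * a / s) ^ q ≤ 2 ^ q * Real.exp q * Real.exp (q * d ^ 2 / s ^ 2) := by
          calc _ ≤ (2 * Real.exp (1 + d ^ 2 / s ^ 2)) ^ q := by gcongr
            _ = _ := by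
              rw [mul_pow, ← Real.exp_nat_mul, mul_assoc, ← Real.exp_add]
              congr 2; ring
        calc _ ≤ γ₂ * (2 ^ q * Real.exp q * Real.exp (q * d ^ 2 / s ^ 2)) := by gcongr
          _ = _ := by ring
      calc A / V x s * Real.exp (-(8 * c + q) * d ^ 2 / s ^ 2)
          = c⁻¹ * (s ^ Q)⁻¹ * ((Real.exp (-(8 * c)) * Real.exp (-(8 * c) * d ^ 2 / s ^ 2)) *
            (c₂ * ((1 / 2 : ℝ) ^ Q * s ^ Q) /
              (γ₂ * 2 ^ q * Real.exp q * Real.exp (q * d ^ 2 / s ^ 2) * V x s))) := by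
            have : -(8 * c + q) * d ^ 2 / s ^ 2 = -(8 * c) * d ^ 2 / s ^ 2 - q * d ^ 2 / s ^ 2 := by
              ring
            rw [this, Real.exp_sub, hA]
            field_simp
        _ ≤ _ := by gcongr
    · have hdZ0 : ∀ η, d ≤ dZ (x, 0) (y, η) := fun η => hproj x y 0 η
      have h1 := aux_upper (volume : Measure (Fin p → ℝ)) (fun η => dZ (x, 0) (y, η))
        (hcont _ _).measurable (fun η => hd0.trans (hdZ0 η)) s c Q (c₁ * s ^ Q / V x s) hs hc
        (by positivity) (by
          intro k
          refine (hslice_up x y (((k:ℝ) + 1) * s) (by positivity)).trans ?_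
          apply ENNReal.ofReal_le_ofReal
          rw [Real.mul_rpow (by positivity) hs.le]
          have : V x s ≤ V x (((k:ℝ) + 1) * s) := by
            apply hVmono x x s _ hs
            rw [hdX_self]
            nlinarith [mul_nonneg (Nat.cast_nonneg k : (0:ℝ) ≤ k) hs.le]
          calc _ ≤ c₁ * (((k:ℝ) + 1) ^ Q * s ^ Q) / V x s := by gcongr
            _ = _ := by ring)
      rw [← hS] at h1
      have h2 : ∫⁻ η : Fin p → ℝ,
            ENNReal.ofReal (Real.exp (-(dZ (x, 0) (y, η)) ^ 2 / (c * s ^ 2))) ≤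
          ENNReal.ofReal (Real.exp (-d ^ 2 / (2 * c * s ^ 2))) *
            ENNReal.ofReal (c₁ * s ^ Q / V x s * S) := by
        refine le_trans ?_ (mul_le_mul_right h1 _)
        rw [← lintegral_const_mul' _ _ ENNReal.ofReal_ne_top]
        apply lintegral_mono
        intro η
        dsimp only
        rw [← ENNReal.ofReal_mul (by positivity), ← Real.exp_add]
        apply ENNReal.ofReal_le_ofReal
        apply Real.exp_le_exp.2
        have h5 : d ^ 2 ≤ (dZ (x, 0) (y, η)) ^ 2 := pow_le_pow_left₀ hd0 (hdZ0 η) 2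
        have h6 : -(dZ (x, 0) (y, η)) ^ 2 / (c * s ^ 2) =
          (-2 * (dZ (x, 0) (y, η)) ^ 2) / (2 * c * s ^ 2) := by field_simp
        rw [h6, ← add_div]
        gcongr
        linarith
      have h3 := (hγ_up x y (s ^ 2) (by positivity)).trans (mul_le_mul_right h2 _)
      rw [← ENNReal.ofReal_mul (by positivity), ← ENNReal.ofReal_mul (by positivity), hpow] at h3
      have h4 := (ENNReal.ofReal_le_ofReal_iff (by positivity)).1 h3
      refine h4.trans (le_of_eq ?_)
      field_simp
  set R : ℝ := 1 + 1 / A + (8 * c + q) + c * c₁ * S + 2 * c with hR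
  have p1 : 0 < 1 / A := by positivity
  have p2 : (0:ℝ) ≤ q := Nat.cast_nonneg q
  have p3 : 0 ≤ c * c₁ * S := by positivity
  refine ⟨R, by linarith, ?_⟩
  intro x y t ht
  have hs : 0 < Real.sqrt t := Real.sqrt_pos.2 ht
  obtain ⟨k1, k2⟩ := key x y (Real.sqrt t) hs
  rw [Real.sq_sqrt ht.le] at k1 k2
  have hV0 := hVpos x _ hs
  have hR0 : 0 < R := by linarith
  constructor
  · refine le_trans ?_ k1
    have hRA : 1 / R ≤ A := by
      rw [div_le_comm₀ hR0 hA0]; linarith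
    have e : 1 / (R * V x (Real.sqrt t)) = (1 / R) / V x (Real.sqrt t) := by
      field_simp
    rw [e]
    have : 8 * c + q ≤ R := by linarith
    gcongr
  · refine k2.trans ?_
    have h1 : c * c₁ * S ≤ R := by linarith
    have h2 : 2 * c ≤ R := by linarith
    have h3 : Real.exp (-(dX x y) ^ 2 / (2 * c * t)) ≤ Real.exp (-(dX x y) ^ 2 / (R * t)) := by
      apply Real.exp_le_exp.2
      rw [neg_div, neg_div]
      gcongr
    gcongr
end
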